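/- Let W be a standard Brownian motion on a probability space (Ω, 𝓕, P), let t > 0 and z ∈ ℝ. Define Z := z + ∫₀ᵗ e^s·W_s ds. Then Z is a Gaussian random variable with mean z and variance ∫₀ᵗ (e^t − e^s)² ds. -/

import Mathlib

open MeasureTheory ProbabilityTheory Real

/-- A standard Brownian motion: a real-valued process with a.s. continuous paths,
`W 0 = 0` a.s., such that every finite collection `(W t₁, …, W tₙ)` (for nonnegative
times) is a centered Gaussian vector with `Cov (W s) (W r) = min s r`; this is
expressed through the one-dimensional laws of all linear combinations. -/
def IsStandardBrownianMotion {Ω : Type*} [MeasureSpace Ω] (W : ℝ → Ω → ℝ) : Prop :=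
  (∀ s : ℝ, Measurable (W s)) ∧
  (∀ᵐ ω : Ω, Continuous fun s : ℝ => W s ω) ∧
  (∀ᵐ ω : Ω, W 0 ω = 0) ∧
  ∀ (n : ℕ) (ts : Fin n → ℝ) (c : Fin n → ℝ), (∀ i, 0 ≤ ts i) →
    Measure.map (fun ω => ∑ i, c i * W (ts i) ω) (ℙ : Measure Ω) =
      gaussianReal 0 (∑ i, ∑ j, c i * c j * min (ts i) (ts j)).toNNReal

open Filter Topology

lemma intervalIntegrable_and_integral_floor (g : ℝ → ℝ) {n : ℕ} (hn : n ≠ 0) (k : ℕ) :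
    IntervalIntegrable (fun u : ℝ => g (⌊u * n⌋₊ / n)) volume (k / n : ℝ) ((k + 1 : ℕ) / n : ℝ) ∧
      ∫ u in (k / n : ℝ)..((k + 1 : ℕ) / n : ℝ), g (⌊u * n⌋₊ / n) = g (k / n) / n := by
  have hn' : (0 : ℝ) < n := by positivity
  have hle : (k / n : ℝ) ≤ ((k + 1 : ℕ) / n : ℝ) := by gcongr; simp
  have heq : ∀ u ∈ Set.Ioo (k / n : ℝ) ((k + 1 : ℕ) / n : ℝ),
      g (⌊u * n⌋₊ / n) = g (k / n) := by
    rintro u ⟨h1, h2⟩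
    rw [div_lt_iff₀ hn'] at h1
    rw [lt_div_iff₀ hn'] at h2
    have : ⌊u * n⌋₊ = k := by
      rw [Nat.floor_eq_iff (le_trans (by positivity) h1.le)]
      exact ⟨h1.le, by simpa using h2⟩
    rw [this]
  constructor
  · rw [intervalIntegrable_iff_integrableOn_Ioo_of_le hle]
    exact (integrableOn_congr_fun heq measurableSet_Ioo).2 (by simp)
  · rw [intervalIntegral.integral_of_le hle, integral_Ioc_eq_integral_Ioo,
      setIntegral_congr_fun measurableSet_Ioo heq, ← integral_Ioc_eq_integral_Ioo,
      ← intervalIntegral.integral_of_le hle, intervalIntegral.integral_const]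
    simp only [smul_eq_mul]
    push_cast
    field_simp
    ring

/-- A Riemann sum over the uniform partition of `[0, 1]` is the integral of a step function. -/
lemma integral_floor_eq_riemannSum (g : ℝ → ℝ) {n : ℕ} (hn : n ≠ 0) :
    ∫ u in (0 : ℝ)..1, g (⌊u * n⌋₊ / n) = ∑ i : Fin n, g (i / n) / n := by
  have h := intervalIntegral.sum_integral_adjacent_intervals (a := fun k : ℕ => (k / n : ℝ))
    (f := fun u : ℝ => g (⌊u * n⌋₊ / n)) (μ := volume) (n := n)
    fun k _ => (intervalIntegrable_and_integral_floor g hn k).1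
  have hn' : (n : ℝ) ≠ 0 := by exact_mod_cast hn
  simp only [Nat.cast_zero, zero_div, div_self hn'] at h
  rw [← h, Finset.sum_range]
  exact Finset.sum_congr rfl fun k _ => (intervalIntegrable_and_integral_floor g hn k).2

lemma floor_mul_div_mem_Icc {u : ℝ} (hu : u ∈ Set.Icc (0 : ℝ) 1) (n : ℕ) :
    (⌊u * n⌋₊ / n : ℝ) ∈ Set.Icc (0 : ℝ) 1 := by
  refine ⟨by positivity, div_le_one_of_le₀ ?_ (by positivity)⟩
  exact (Nat.floor_le (mul_nonneg hu.1 (by positivity))).trans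
    (mul_le_of_le_one_left (by positivity) hu.2)

lemma tendsto_floor_mul_div {u : ℝ} (hu : 0 ≤ u) :
    Tendsto (fun n : ℕ => (⌊u * n⌋₊ / n : ℝ)) atTop (𝓝 u) :=
  (tendsto_nat_floor_mul_div_atTop hu).comp tendsto_natCast_atTop_atTop

/-- Convergence of Riemann sums of a uniformly bounded sequence of integrands which converges
along the left endpoints of the partition intervals. -/
lemma tendsto_riemannSum_of_bounded {G : ℕ → ℝ → ℝ} {g : ℝ → ℝ} {C : ℝ}
    (hG : ∀ n, Measurable (G n)) (hC : ∀ n, ∀ x ∈ Set.Icc (0 : ℝ) 1, |G n x| ≤ C)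
    (hlim : ∀ u ∈ Set.Icc (0 : ℝ) 1, Tendsto (fun n : ℕ => G n (⌊u * n⌋₊ / n)) atTop (𝓝 (g u))) :
    Tendsto (fun n : ℕ => ∑ i : Fin n, G n (i / n) / n) atTop (𝓝 (∫ u in (0 : ℝ)..1, g u)) := by
  have key : Tendsto (fun n : ℕ => ∫ u in (0 : ℝ)..1, G n (⌊u * n⌋₊ / n)) atTop
      (𝓝 (∫ u in (0 : ℝ)..1, g u)) := by
    have hsub : Set.uIoc (0 : ℝ) 1 ⊆ Set.Icc 0 1 := by
      rw [Set.uIoc_of_le zero_le_one]; exact Set.Ioc_subset_Icc_self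
    refine intervalIntegral.tendsto_integral_filter_of_dominated_convergence (fun _ => C)
      (.of_forall fun n => ?_) (.of_forall fun n => .of_forall fun u hu => ?_) (by simp)
      (.of_forall fun u hu => hlim u (hsub hu))
    · refine ((hG n).comp ?_).aestronglyMeasurable
      exact (measurable_from_nat.comp
        (Nat.measurable_floor.comp (measurable_id.mul_const _))).div_const _
    · exact hC n _ (floor_mul_div_mem_Icc (hsub hu) n)
  refine key.congr' ?_
  filter_upwards [eventually_ne_atTop 0] with n hn
  exact integral_floor_eq_riemannSum (G n) hn

lemma tendsto_riemannSum {g : ℝ → ℝ} (hg : Continuous g) :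
    Tendsto (fun n : ℕ => ∑ i : Fin n, g (i / n) / n) atTop (𝓝 (∫ u in (0 : ℝ)..1, g u)) := by
  obtain ⟨C, hC⟩ := isCompact_Icc.exists_bound_of_continuousOn (s := Set.Icc (0 : ℝ) 1)
    hg.continuousOn
  exact tendsto_riemannSum_of_bounded (fun _ => hg.measurable) (fun _ => hC)
    fun u hu => (hg.tendsto u).comp (tendsto_floor_mul_div hu.1)

lemma tendsto_double_riemannSum {F : ℝ → ℝ → ℝ} (hF : Continuous fun p : ℝ × ℝ => F p.1 p.2) :
    Tendsto (fun n : ℕ => ∑ i : Fin n, (∑ j : Fin n, F (i / n) (j / n) / n) / n) atTop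
      (𝓝 (∫ u in (0 : ℝ)..1, ∫ v in (0 : ℝ)..1, F u v)) := by
  obtain ⟨C, hC⟩ := (isCompact_Icc.prod isCompact_Icc).exists_bound_of_continuousOn
    (s := Set.Icc (0 : ℝ) 1 ×ˢ Set.Icc (0 : ℝ) 1) hF.continuousOn
  have hC0 : 0 ≤ C := (norm_nonneg _).trans (hC (0, 0) (by simp))
  refine tendsto_riemannSum_of_bounded (C := C)
    (G := fun n x => ∑ j : Fin n, F x (j / n) / n) (fun n => ?_) (fun n x hx => ?_)
    fun u hu => ?_
  · refine Continuous.measurable (continuous_finsetSum _ fun j _ => Continuous.div_const ?_ _)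
    exact hF.comp (continuous_id.prodMk continuous_const)
  · calc |∑ j : Fin n, F x (j / n) / n| ≤ ∑ j : Fin n, |F x (j / n) / n| :=
          Finset.abs_sum_le_sum_abs _ _
      _ ≤ ∑ _j : Fin n, C / n := by
          refine Finset.sum_le_sum fun j _ => ?_
          rw [abs_div, Nat.abs_cast]
          gcongr
          refine hC (x, j / n) ⟨hx, by positivity, div_le_one_of_le₀ ?_ (by positivity)⟩
          exact_mod_cast j.2.le
      _ ≤ C := by
          rcases eq_or_ne n 0 with rfl | hn
          · simpa using hC0
          · simp only [Finset.sum_const, Finset.card_univ, Fintype.card_fin, nsmul_eq_mul]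
            field_simp
            exact le_rfl
  · refine tendsto_riemannSum_of_bounded (C := C)
      (G := fun n y => F (⌊u * n⌋₊ / n) y) (fun n => ?_) (fun n y hy => ?_) fun v hv => ?_
    · exact (hF.comp (continuous_const.prodMk continuous_id)).measurable
    · exact hC (_, y) ⟨floor_mul_div_mem_Icc hu n, hy⟩
    · exact (hF.tendsto (u, v)).comp
        ((tendsto_floor_mul_div hu.1).prodMk_nhds (tendsto_floor_mul_div hv.1))

/-- An almost sure limit of centered Gaussian variables with converging variances is Gaussian. -/
lemma map_eq_gaussianReal_of_tendsto {Ω : Type*} {mΩ : MeasurableSpace Ω} {P : Measure Ω}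
    [IsProbabilityMeasure P] {S : ℕ → Ω → ℝ} {Y : Ω → ℝ} {v : ℕ → NNReal} {v' : NNReal}
    (hS : ∀ n, Measurable (S n)) (hlaw : ∀ n, P.map (S n) = gaussianReal 0 (v n))
    (hlim : ∀ᵐ ω ∂P, Tendsto (fun n => S n ω) atTop (𝓝 (Y ω)))
    (hv : Tendsto v atTop (𝓝 v')) : P.map Y = gaussianReal 0 v' := by
  have hY : AEMeasurable Y P :=
    aemeasurable_of_tendsto_metrizable_ae atTop (fun n => (hS n).aemeasurable) hlim
  have := Measure.isProbabilityMeasure_map hY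
  refine Measure.ext_of_charFun (funext fun ξ => ?_)
  have h1 : Tendsto (fun n => charFun (P.map (S n)) ξ) atTop (𝓝 (charFun (P.map Y) ξ)) := by
    simp_rw [charFun_apply_real]
    rw [integral_map hY (by fun_prop)]
    simp_rw [fun n => integral_map (hS n).aemeasurable (μ := P)
      (f := fun x : ℝ => Complex.exp (ξ * x * Complex.I)) (by fun_prop)]
    refine tendsto_integral_of_dominated_convergence (fun _ => 1) (fun n => ?_) (by simp)
      (fun n => .of_forall fun ω => ?_) ?_
    · have := hS n
      fun_prop
    · rw [← Complex.ofReal_mul, Complex.norm_exp_ofReal_mul_I]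
    · filter_upwards [hlim] with ω hω
      exact ((by fun_prop : Continuous fun x : ℝ =>
        Complex.exp (ξ * x * Complex.I)).tendsto _).comp hω
  refine tendsto_nhds_unique h1 ?_
  simp_rw [hlaw, charFun_gaussianReal]
  exact ((by fun_prop : Continuous fun w : NNReal =>
    Complex.exp (ξ * (0 : ℝ) * Complex.I - (w : ℝ) * ξ ^ 2 / 2)).tendsto _).comp hv

lemma integral_exp_mul_min {t s : ℝ} (hs : 0 ≤ s) (hst : s ≤ t) :
    ∫ r in (0 : ℝ)..t, exp r * min s r = s * exp t - exp s + 1 := by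
  have hint : ∀ a b : ℝ, IntervalIntegrable (fun r => exp r * min s r) volume a b :=
    fun a b => Continuous.intervalIntegrable (by fun_prop) a b
  rw [← intervalIntegral.integral_add_adjacent_intervals (hint 0 s) (hint s t)]
  have h1 : ∫ r in (0 : ℝ)..s, exp r * min s r = ∫ r in (0 : ℝ)..s, exp r * r := by
    refine intervalIntegral.integral_congr fun r hr => ?_
    rw [Set.uIcc_of_le hs] at hr
    simp only [min_eq_right hr.2]
  have h2 : ∫ r in s..t, exp r * min s r = ∫ r in s..t, exp r * s := by
    refine intervalIntegral.integral_congr fun r hr => ?_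
    rw [Set.uIcc_of_le hst] at hr
    simp only [min_eq_left hr.1]
  have h3 : ∫ r in (0 : ℝ)..s, exp r * r = (s - 1) * exp s - (0 - 1) * exp 0 := by
    refine intervalIntegral.integral_eq_sub_of_hasDerivAt (f := fun r => (r - 1) * exp r)
      (fun r _ => ?_) (Continuous.intervalIntegrable (by fun_prop) _ _)
    exact (((hasDerivAt_id' r).sub_const 1).mul (hasDerivAt_exp r)).congr_deriv (by ring)
  rw [h1, h2, h3, intervalIntegral.integral_mul_const, integral_exp, exp_zero]
  ring

lemma integral_exp_mul_integral_exp_mul_min {t : ℝ} (ht : 0 ≤ t) :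
    ∫ s in (0 : ℝ)..t, exp s * ∫ r in (0 : ℝ)..t, exp r * min s r =
      ∫ s in (0 : ℝ)..t, (exp t - exp s) ^ 2 := by
  have h1 : ∫ s in (0 : ℝ)..t, exp s * ∫ r in (0 : ℝ)..t, exp r * min s r =
      ∫ s in (0 : ℝ)..t, exp s * (s * exp t - exp s + 1) := by
    refine intervalIntegral.integral_congr fun s hs => ?_
    rw [Set.uIcc_of_le ht] at hs
    simp only [integral_exp_mul_min hs.1 hs.2]
  rw [h1, ← sub_eq_zero, ← intervalIntegral.integral_sub
    (Continuous.intervalIntegrable (by fun_prop) _ _)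
    (Continuous.intervalIntegrable (by fun_prop) _ _)]
  rw [intervalIntegral.integral_eq_sub_of_hasDerivAt
    (f := fun s => exp t * ((s + 1) * exp s) + exp s - exp t ^ 2 * s - exp s * exp s)
    (fun s _ => ?_) (Continuous.intervalIntegrable (by fun_prop) _ _)]
  · simp only [exp_zero]
    ring
  · have he := hasDerivAt_exp s
    exact ((((((hasDerivAt_id' s).add_const 1).mul he).const_mul (exp t)).add he).sub
      ((hasDerivAt_id' s).const_mul (exp t ^ 2)) |>.sub (he.mul he)).congr_deriv (by ring)

theorem example3_exponential_position_gaussian_law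
    {Ω : Type*} [MeasureSpace Ω] [IsProbabilityMeasure (ℙ : Measure Ω)]
    (W : ℝ → Ω → ℝ) (hW : IsStandardBrownianMotion W)
    (t : ℝ) (ht : 0 < t) (z : ℝ) (Z : Ω → ℝ)
    (hZ : Z = fun ω => z + ∫ s in (0:ℝ)..t, Real.exp s * W s ω) :
    Measure.map Z (ℙ : Measure Ω) =
      gaussianReal z ((∫ s in (0:ℝ)..t, (Real.exp t - Real.exp s) ^ 2).toNNReal) := by
  obtain ⟨hmeas, hcont, -, hlaw⟩ := hW
  have hY : Measure.map (fun ω => ∫ s in (0:ℝ)..t, exp s * W s ω) (ℙ : Measure Ω) =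
      gaussianReal 0 ((∫ s in (0:ℝ)..t, (exp t - exp s) ^ 2).toNNReal) := by
    refine map_eq_gaussianReal_of_tendsto
      (S := fun n ω => ∑ i : Fin n, t * exp (t * (i / n)) / n * W (t * (i / n)) ω)
      (fun n => Finset.measurable_sum _ fun i _ => (hmeas _).const_mul _)
      (fun n => hlaw n _ _ fun i => by positivity) ?_ ?_
    · filter_upwards [hcont] with ω hω
      have h := tendsto_riemannSum
        (g := fun u => t * (exp (t * u) * W (t * u) ω)) (by fun_prop)
      rw [intervalIntegral.integral_const_mul,
        intervalIntegral.mul_integral_comp_mul_left (f := fun s => exp s * W s ω)] at h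
      simp only [mul_zero, mul_one] at h
      refine h.congr fun n => Finset.sum_congr rfl fun i _ => ?_
      ring
    · refine (continuous_real_toNNReal.tendsto _).comp ?_
      have h := tendsto_double_riemannSum
        (F := fun u v => t * (exp (t * u) * (t * (exp (t * v) * min (t * u) (t * v)))))
        (by fun_prop)
      simp only [intervalIntegral.integral_const_mul] at h
      simp_rw [fun x : ℝ => intervalIntegral.mul_integral_comp_mul_left
        (f := fun r => exp r * min (t * x) r) (a := 0) (b := 1) t] at h
      rw [intervalIntegral.mul_integral_comp_mul_left
        (f := fun s => exp s * ∫ r in t * 0..t * 1, exp r * min s r)] at h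
      simp only [mul_zero, mul_one] at h
      rw [integral_exp_mul_integral_exp_mul_min ht.le] at h
      refine h.congr fun n => Finset.sum_congr rfl fun i _ => ?_
      rw [Finset.sum_div]
      refine Finset.sum_congr rfl fun j _ => ?_
      ring
  have hYm : AEMeasurable (fun ω => ∫ s in (0:ℝ)..t, exp s * W s ω) (ℙ : Measure Ω) := by
    by_contra h
    rw [Measure.map_of_not_aemeasurable h] at hY
    exact IsProbabilityMeasure.ne_zero _ hY.symm
  have hmap := AEMeasurable.map_map_of_aemeasurable (g := fun y : ℝ => z + y)
    (by fun_prop) hYm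
  rw [hY, gaussianReal_map_const_add, zero_add] at hmap
  rw [hZ]
  exact hmap.symm
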